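/- Let I be an arbitrary set and for each i ∈ I let E_i be a nonempty set. Let E = Π_{i ∈ I} E_i and let 𝔤 be the real vector space of all functions from E to ℝ. For a finite subset b of I, let F(b) be the subspace of 𝔤 of functions factoring through the restriction map π_b : E → Π_{i ∈ b} E_i, and for an arbitrary subset a ⊆ I define the generalized factor subspace H(a) = ⨆_{b finite, b ⊆ a} F(b). Then the monotone map H : 𝒫(I) → Submodule ℝ 𝔤 (where 𝒫(I) is the powerset of I ordered by inclusion) is decomposable: there exists a family s : 𝒫(I) → Submodule ℝ 𝔤 which is independent (for every a ⊆ I, s a ⊓ (⨆_{b ⊆ I, b ≠ a} s b) = ⊥) and satisfies H(a) = ⨆_{b ⊆ a} s b for every a ⊆ I. -/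

import Mathlib

/-- The factor subspace `F b ≤ (E → ℝ)`, for a finite subset `b : Finset I`, of
functions factoring through the restriction map `π_b : (∀ i, E i) → (∀ i : b, E i)`. -/
def factorSubspaceFinset {I : Type*} (E : I → Type*) (b : Finset I) :
    Submodule ℝ ((∀ i, E i) → ℝ) :=
  LinearMap.range (LinearMap.funLeft ℝ ℝ (fun (x : ∀ i, E i) (i : b) => x i.1))

/-- The generalized factor subspace `H a = ⨆_{b finite, b ⊆ a} F b`, for an
arbitrary subset `a ⊆ I`. -/
def generalizedFactorSubspace {I : Type*} (E : I → Type*) (a : Set I) :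
    Submodule ℝ ((∀ i, E i) → ℝ) :=
  ⨆ b : Finset I, ⨆ _ : (b : Set I) ⊆ a, factorSubspaceFinset E b

theorem mem_factorSubspaceFinset {I : Type*} {E : I → Type*} (e : ∀ i, E i) {b : Finset I}
    {f : (∀ i, E i) → ℝ} : f ∈ factorSubspaceFinset E b ↔ DependsOn f (b : Set I) := by
  classical
  constructor
  · rintro ⟨g, rfl⟩ x y h
    simp only [LinearMap.funLeft_apply]
    congr 1
    funext i
    exact h i.1 i.2
  · intro hf
    refine ⟨fun z => f fun i => if h : i ∈ b then z ⟨i, h⟩ else e i, ?_⟩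
    funext x
    simp only [LinearMap.funLeft_apply]
    refine hf fun i hi => ?_
    simp [Finset.mem_coe.1 hi]

/-- The functions depending only on the coordinates in `a` and vanishing as soon as one of these
coordinates agrees with the base point `e`; the zero subspace if `a` is infinite. -/
def pureInteractionSubspace {I : Type*} {E : I → Type*} (e : ∀ i, E i) (a : Set I) :
    Submodule ℝ ((∀ i, E i) → ℝ) where
  carrier := {f | (a.Infinite → f = 0) ∧ DependsOn f a ∧ ∀ x, ∀ i ∈ a, x i = e i → f x = 0}
  zero_mem' := ⟨fun _ => rfl, fun _ _ _ => rfl, fun _ _ _ _ => rfl⟩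
  add_mem' := by
    rintro f g ⟨hf, hfdep, hfvan⟩ ⟨hg, hgdep, hgvan⟩
    refine ⟨fun h => by rw [hf h, hg h, add_zero], fun x y h => ?_, fun x i hi hx => ?_⟩
    · simp [hfdep h, hgdep h]
    · simp [hfvan x i hi hx, hgvan x i hi hx]
  smul_mem' := by
    rintro c f ⟨hf, hfdep, hfvan⟩
    refine ⟨fun h => by rw [hf h, smul_zero], fun x y h => ?_, fun x i hi hx => ?_⟩
    · simp [hfdep h]
    · simp [hfvan x i hi hx]

theorem iSupIndep_pureInteractionSubspace {I : Type*} {E : I → Type*} (e : ∀ i, E i) :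
    iSupIndep (pureInteractionSubspace e) := by
  classical
  rw [iSupIndep_iff_finsetSum_eq_zero_imp_eq_zero]
  intro s v hv hsum a ha
  by_cases hfin : a.Finite
  swap
  · exact (hv a ha).1 hfin
  lift a to Finset I using hfin
  induction a using Finset.strongInduction with
  | H a ih =>
    funext x
    set y : ∀ i, E i := (a : Set I).piecewise x e with hy
    have hay : v a x = v a y := (hv a ha).2.1 fun i hi => by
      rw [hy, Set.piecewise_eq_of_mem _ _ _ hi]
    have hother : ∀ c ∈ s, c ≠ (a : Set I) → v c y = 0 := fun c hc hca => by
      by_cases hsub : c ⊆ a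
      · lift c to Finset I using a.finite_toSet.subset hsub
        have hlt : c ⊂ a := Finset.ssubset_iff_subset_ne.2
          ⟨Finset.coe_subset.1 hsub, fun h => hca (congrArg _ h)⟩
        rw [ih c hlt hc, Pi.zero_apply]
      · obtain ⟨i, hic, hia⟩ := Set.not_subset.1 hsub
        exact (hv c hc).2.2 y i hic (Set.piecewise_eq_of_notMem _ _ _ hia)
    have hsumy := congrFun hsum y
    rwa [Finset.sum_apply, Finset.sum_eq_single_of_mem _ ha hother, ← hay] at hsumy

/-- Splitting off the coordinates in `d` one at a time, replacing each by its base point. -/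
theorem mem_iSup_pureInteractionSubspace {I : Type*} {E : I → Type*} (e : ∀ i, E i)
    (d : Finset I) (t : Finset I) {f : (∀ i, E i) → ℝ} (hf : DependsOn f (d ∪ t : Set I))
    (hvan : ∀ x, ∀ i ∈ t, x i = e i → f x = 0) :
    f ∈ ⨆ c, ⨆ _ : c ≤ (d ∪ t : Set I), pureInteractionSubspace e c := by
  classical
  induction d using Finset.induction_on generalizing t f with
  | empty =>
    refine Submodule.mem_iSup_of_mem (t : Set I) (Submodule.mem_iSup_of_mem (by simp) ?_)
    exact ⟨fun h => absurd t.finite_toSet h, by simpa using hf, hvan⟩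
  | insert i d hi ih =>
    let r : (∀ i, E i) → ℝ := fun x => f (Function.update x i (e i))
    have hr : r ∈ ⨆ c, ⨆ _ : c ≤ (d ∪ t : Set I), pureInteractionSubspace e c := by
      refine ih t (fun x y h => hf fun j hj => ?_) fun x j hj hx => hvan _ j hj ?_
      · by_cases hji : j = i
        · subst hji; simp
        · simpa [hji] using h j (by simpa [hji] using hj)
      · by_cases hji : j = i
        · subst hji; simp
        · simpa [hji] using hx
    have hfr : f - r ∈ ⨆ c, ⨆ _ : c ≤ (d ∪ (insert i t : Finset I) : Set I),
        pureInteractionSubspace e c := by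
      refine ih (insert i t) (fun x y h => ?_) fun x j hj hx => ?_
      · have hxy : f x = f y := hf fun j hj => h j (by simpa [or_left_comm, or_assoc] using hj)
        have hrxy : r x = r y := hf fun j hj => by
          by_cases hji : j = i
          · subst hji; simp
          · simpa [hji] using h j (by simpa [hji] using hj)
        simp [hxy, hrxy]
      · rcases Finset.mem_insert.1 hj with rfl | hj
        · simp [r, ← hx]
        · have hrx : r x = 0 := hvan _ j hj (by
            by_cases hji : j = i
            · subst hji; simp
            · simpa [hji] using hx)
          simp [hvan x j hj hx, hrx]
    rw [← sub_add_cancel f r]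
    refine Submodule.add_mem _ ?_ ?_
    · refine SetLike.le_def.1 (biSup_mono fun c hc => le_trans hc ?_) hfr
      grind
    · refine SetLike.le_def.1 (biSup_mono fun c hc => le_trans hc ?_) hr
      grind

theorem factorSubspaceFinset_le_iSup {I : Type*} {E : I → Type*} (e : ∀ i, E i) (b : Finset I) :
    factorSubspaceFinset E b ≤ ⨆ c, ⨆ _ : c ≤ (b : Set I), pureInteractionSubspace e c := by
  intro f hf
  rw [mem_factorSubspaceFinset e] at hf
  simpa using mem_iSup_pureInteractionSubspace e b ∅ (f := f) (by simpa using hf) (by simp)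

theorem pureInteractionSubspace_le_generalizedFactorSubspace {I : Type*} {E : I → Type*}
    (e : ∀ i, E i) (a : Set I) :
    pureInteractionSubspace e a ≤ generalizedFactorSubspace E a := by
  intro f hf
  by_cases ha : a.Finite
  · lift a to Finset I using ha
    exact Submodule.mem_iSup_of_mem a
      (Submodule.mem_iSup_of_mem subset_rfl ((mem_factorSubspaceFinset e).2 hf.2.1))
  · rw [hf.1 ha]
    exact Submodule.zero_mem _

/-- For an arbitrary set `I` and nonempty sets `E i`, the monotone map
`a ↦ H a` on the powerset of `I` (ordered by inclusion) is decomposable. -/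
theorem stmt_19 {I : Type*} (E : I → Type*) (hE : ∀ i, Nonempty (E i)) :
    ∃ s : Set I → Submodule ℝ ((∀ i, E i) → ℝ),
      (∀ a : Set I, s a ⊓ (⨆ b, ⨆ _ : b ≠ a, s b) = ⊥) ∧
      (∀ a : Set I, generalizedFactorSubspace E a = ⨆ b, ⨆ _ : b ≤ a, s b) := by
  let e : ∀ i, E i := fun i => (hE i).some
  refine ⟨pureInteractionSubspace e,
    fun a => (iSupIndep_pureInteractionSubspace e a).eq_bot, fun a => le_antisymm ?_ ?_⟩
  · exact iSup₂_le fun b hb => (factorSubspaceFinset_le_iSup e b).trans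
      (biSup_mono fun c hc => hc.trans hb)
  · exact iSup₂_le fun b hb => (pureInteractionSubspace_le_generalizedFactorSubspace e b).trans
      (biSup_mono fun c hc => hc.trans hb)
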